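/- arXiv:math/0212270 — 5 statements merged into one kernel-verified Lean document; each statement's English description precedes it below -/
import Mathlib

section
/- Let λ be a partition of the natural number f in which every even part occurs with even multiplicity, let p be the number of parts of λ, let o(λ) be the number of odd parts of λ, and let λᵀ denote its transpose. For t ∈ ℕ let λ_t be the partition of f+t obtained from λ by adjoining t additional parts equal to 1 (again every even part occurs with even multiplicity). Then ½((f+t)² − (f+t) − Σ_i ((λ_t)ᵀ_i)² + o(λ_t)) = ½(f² − f − Σ_i (λᵀ_i)² + o(λ)) + t·(f − p). In particular, the dimension of the corresponding nilpotent orbit of so_{f+t}(ℂ), given by the standard formula, is a linear (affine) function of t. (Proposition 4.3, so-case.) -/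
/-!
STATEMENT 1 (Proposition 4.3, so-case).
For a partition `λ` of `f` in which every even part occurs with even
multiplicity, with `p` parts and `o(λ)` odd parts, and `λ_t` obtained by
adjoining `t` extra parts equal to `1` (again every even part occurs with
even multiplicity), we have
`½((f+t)² − (f+t) − Σ_i ((λ_t)ᵀ_i)² + o(λ_t)) = ½(f² − f − Σ_i (λᵀ_i)² + o(λ)) + t(f − p)`,
so the standard dimension formula for the corresponding nilpotent orbit of
`so_{f+t}(ℂ)` is an affine function of `t`.
-/

/-- The `i`-th part of the transpose partition: `λᵀ_i = #{j : λ_j ≥ i}`. -/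
def conjPart (μ : Multiset ℕ) (i : ℕ) : ℕ := (μ.filter (fun x => i ≤ x)).card

/-- `Σ_i (μᵀ_i)²`, summed over `1 ≤ i ≤ n` (the transpose vanishes beyond the
size of the partition), as a rational number. -/
def sumConjSq (μ : Multiset ℕ) (n : ℕ) : ℚ :=
  ∑ i ∈ Finset.Icc 1 n, (conjPart μ i : ℚ) ^ 2

/-- `o(μ)`: the number of odd parts of `μ`. -/
def oddCount (μ : Multiset ℕ) : ℕ := (μ.filter (fun x => Odd x)).card

theorem conjPart_one {μ : Multiset ℕ} (hpos : ∀ x ∈ μ, 0 < x) :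
    conjPart μ 1 = Multiset.card μ := by
  exact congrArg Multiset.card (Multiset.filter_eq_self.2 hpos)

theorem conjPart_eq_zero_of_sum_lt {μ : Multiset ℕ} {i : ℕ} (hi : μ.sum < i) :
    conjPart μ i = 0 := by
  rw [conjPart, Multiset.card_eq_zero, Multiset.filter_eq_nil]
  intro x hx
  have := Multiset.le_sum_of_mem hx
  omega

theorem conjPart_add_replicate_one (μ : Multiset ℕ) (t : ℕ) {i : ℕ} (hi : 1 ≤ i) :
    conjPart (μ + Multiset.replicate t 1) i = conjPart μ i + if i = 1 then t else 0 := by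
  rw [conjPart, conjPart, Multiset.filter_add, Multiset.card_add]
  congr 1
  split_ifs with h
  · rw [Multiset.filter_eq_self.2, Multiset.card_replicate]
    intro x hx
    rw [Multiset.eq_of_mem_replicate hx, h]
  · rw [Multiset.card_eq_zero, Multiset.filter_eq_nil]
    intro x hx
    have := Multiset.eq_of_mem_replicate hx
    omega

theorem oddCount_add_replicate_one (μ : Multiset ℕ) (t : ℕ) :
    oddCount (μ + Multiset.replicate t 1) = oddCount μ + t := by
  rw [oddCount, oddCount, Multiset.filter_add, Multiset.card_add]
  congr 1
  rw [Multiset.filter_eq_self.2, Multiset.card_replicate]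
  intro x hx
  rw [Multiset.eq_of_mem_replicate hx]
  exact odd_one

theorem sumConjSq_eq_of_sum_le {μ : Multiset ℕ} {n : ℕ} (hn : μ.sum ≤ n) :
    sumConjSq μ n = sumConjSq μ μ.sum := by
  symm
  apply Finset.sum_subset (Finset.Icc_subset_Icc_right hn)
  intro i hi hi'
  rw [Finset.mem_Icc] at hi hi'
  rw [conjPart_eq_zero_of_sum_lt (by omega)]
  norm_num

theorem sumConjSq_add_replicate_one {μ : Multiset ℕ} (hpos : ∀ x ∈ μ, 0 < x) (t : ℕ) :
    sumConjSq (μ + Multiset.replicate t 1) (μ.sum + t)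
      = sumConjSq μ μ.sum + (2 * (Multiset.card μ : ℚ) * t + (t : ℚ) ^ 2) := by
  rw [← sumConjSq_eq_of_sum_le (Nat.le_add_right μ.sum t)]
  have hterm : ∀ i ∈ Finset.Icc 1 (μ.sum + t),
      (conjPart (μ + Multiset.replicate t 1) i : ℚ) ^ 2 = (conjPart μ i : ℚ) ^ 2
        + if i = 1 then 2 * (Multiset.card μ : ℚ) * t + (t : ℚ) ^ 2 else 0 := by
    intro i hi
    rw [conjPart_add_replicate_one μ t (Finset.mem_Icc.1 hi).1]
    split_ifs with h
    · rw [h, conjPart_one hpos]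
      push_cast
      ring
    · simp
  rw [sumConjSq, Finset.sum_congr rfl hterm, Finset.sum_add_distrib, Finset.sum_ite_eq', sumConjSq]
  congr 1
  split_ifs with h
  · rfl
  · have ht : t = 0 := by
      rw [Finset.mem_Icc] at h
      omega
    simp [ht]

theorem so_orbit_dimension_linear_in_t
    (f : ℕ) (l : Multiset ℕ)
    (hpos : ∀ x ∈ l, 0 < x) (hsum : l.sum = f)
    (heven : ∀ k, Even k → Even (l.count k))
    (p : ℕ) (hp : p = Multiset.card l) (t : ℕ) :
    (∀ k, Even k → Even ((l + Multiset.replicate t 1).count k)) ∧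
    (1 / 2 : ℚ) * (((f + t : ℕ) : ℚ) ^ 2 - ((f + t : ℕ) : ℚ)
        - sumConjSq (l + Multiset.replicate t 1) (f + t)
        + (oddCount (l + Multiset.replicate t 1) : ℚ))
      = (1 / 2 : ℚ) * ((f : ℚ) ^ 2 - (f : ℚ) - sumConjSq l f + (oddCount l : ℚ))
        + (t : ℚ) * ((f : ℚ) - (p : ℚ)) := by
  subst hsum hp
  constructor
  · intro k hk
    have hk1 : 1 ≠ k := by
      rintro rfl
      exact absurd hk (by decide)
    rw [Multiset.count_add, Multiset.count_replicate, if_neg hk1, add_zero]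
    exact heven k hk
  · rw [sumConjSq_add_replicate_one hpos, oddCount_add_replicate_one]
    push_cast
    ring
end

section
/- For each a ∈ {2, 4, 8}, in the polynomial ring ℤ[X] the polynomial X^{a/2+2} − 1 divides the product (X^a − 1)(X^{3a/2} − 1)(X^{3a/2+2} − 1)(X^{2a+2} − 1)(X^{2a+4} − 1)(X^{5a/2+4} − 1)(X^{3a+6} − 1), and the quotient has degree 13a + 16. Consequently Z_{g²g₂²g₃²g_Q²}(q) = q^{11a+8} · (that quotient evaluated at q) is a polynomial in q of degree 24a + 24, which equals the dimension of the nilpotent orbit O_a of the series labeled g²g₂²g₃²g_Q² in the exceptional Lie algebras. -/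
/-!
STATEMENT 7.
For each `a ∈ {2,4,8}`, in `ℤ[X]` the polynomial `X^{a/2+2} − 1` divides
`(X^a−1)(X^{3a/2}−1)(X^{3a/2+2}−1)(X^{2a+2}−1)(X^{2a+4}−1)(X^{5a/2+4}−1)(X^{3a+6}−1)`,
the quotient `Q` has degree `13a+16`, and
`Z_{g²g₂²g₃²g_Q²}(q) = q^{11a+8}·Q(q)` is a polynomial of degree `24a+24`,
the dimension of the nilpotent orbit `O_a` of the series `g²g₂²g₃²g_Q²`.
-/

open Polynomial

theorem natDegree_X_pow_sub_one (n : ℕ) : ((X : ℤ[X]) ^ n - 1).natDegree = n := by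
  simpa using natDegree_X_pow_sub_C (R := ℤ) (n := n) (r := 1)

theorem monic_X_pow_sub_one {n : ℕ} (hn : n ≠ 0) : ((X : ℤ[X]) ^ n - 1).Monic := by
  simpa using monic_X_pow_sub_C (1 : ℤ) hn

theorem X_pow_sub_one_dvd_of_dvd {m n : ℕ} (h : m ∣ n) :
    (X : ℤ[X]) ^ m - 1 ∣ X ^ n - 1 := by
  obtain ⟨k, rfl⟩ := h
  simpa [pow_mul] using sub_dvd_pow_sub_pow ((X : ℤ[X]) ^ m) 1 k

theorem X_pow_sub_one_dvd_regular_series {a : ℕ} (ha : a ∈ ({2, 4, 8} : Set ℕ)) :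
    (X : ℤ[X]) ^ (a / 2 + 2) - 1 ∣
      (X ^ a - 1) * (X ^ (3 * a / 2) - 1) * (X ^ (3 * a / 2 + 2) - 1) *
        (X ^ (2 * a + 2) - 1) * (X ^ (2 * a + 4) - 1) *
        (X ^ (5 * a / 2 + 4) - 1) * (X ^ (3 * a + 6) - 1) := by
  have h : a / 2 + 2 ∣ a ∨ a / 2 + 2 ∣ 3 * a / 2 := by
    rcases ha with rfl | rfl | rfl <;> decide
  iterate 5 refine Dvd.dvd.mul_right ?_ _
  rcases h with h | h
  · exact (X_pow_sub_one_dvd_of_dvd h).mul_right _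
  · exact (X_pow_sub_one_dvd_of_dvd h).mul_left _

theorem rational_points_regular_series_polynomial :
    ∀ a ∈ ({2, 4, 8} : Set ℕ),
      ∃ Q : Polynomial ℤ,
        (X ^ a - 1) * (X ^ (3 * a / 2) - 1) * (X ^ (3 * a / 2 + 2) - 1) *
            (X ^ (2 * a + 2) - 1) * (X ^ (2 * a + 4) - 1) *
            (X ^ (5 * a / 2 + 4) - 1) * (X ^ (3 * a + 6) - 1)
          = (X ^ (a / 2 + 2) - 1) * Q
        ∧ Q.natDegree = 13 * a + 16
        ∧ ((X : Polynomial ℤ) ^ (11 * a + 8) * Q).natDegree = 24 * a + 24 := by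
  intro a ha
  obtain ⟨Q, hQ⟩ := X_pow_sub_one_dvd_regular_series ha
  have hpos : a ≠ 0 ∧ 2 ∣ a := by rcases ha with rfl | rfl | rfl <;> decide
  obtain ⟨ha0, b, rfl⟩ := hpos
  have m {n : ℕ} (hn : n ≠ 0) := monic_X_pow_sub_one hn
  have m₁ := m (n := 2 * b) ha0
  have m₂ := m₁.mul (m (n := 3 * (2 * b) / 2) (by omega))
  have m₃ := m₂.mul (m (n := 3 * (2 * b) / 2 + 2) (by omega))
  have m₄ := m₃.mul (m (n := 2 * (2 * b) + 2) (by omega))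
  have m₅ := m₄.mul (m (n := 2 * (2 * b) + 4) (by omega))
  have m₆ := m₅.mul (m (n := 5 * (2 * b) / 2 + 4) (by omega))
  have m₇ := m (n := 3 * (2 * b) + 6) (by omega)
  have hQm : Q.Monic :=
    (m (n := 2 * b / 2 + 2) (by omega)).of_mul_monic_left (hQ ▸ m₆.mul m₇)
  have hdeg : Q.natDegree = 13 * (2 * b) + 16 := by
    have h := congrArg natDegree hQ
    rw [(m (by omega)).natDegree_mul hQm, m₆.natDegree_mul m₇,
      m₅.natDegree_mul (m (by omega)), m₄.natDegree_mul (m (by omega)),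
      m₃.natDegree_mul (m (by omega)), m₂.natDegree_mul (m (by omega)),
      m₁.natDegree_mul (m (by omega))] at h
    simp only [natDegree_X_pow_sub_one] at h
    omega
  refine ⟨Q, hQ, hdeg, ?_⟩
  rw [(monic_X_pow _).natDegree_mul hQm, natDegree_X_pow, hdeg]
  ring
end

section
/- For each a ∈ {2, 4, 8}, in the polynomial ring ℤ[X] the product (X^{a/2} − 1)(X^{a/2+2} − 1)(X^{a+2} − 1)(X^{a+4} − 1) divides the product (X^{3a/2} − 1)(X^{3a/2+2} − 1)(X^{2a+2} − 1)(X^{2a+4} − 1)(X^{5a/2+4} − 1)(X^{3a+6} − 1), and the quotient has degree (19a + 20)/2. Consequently Z_{g_Q}(q) = q^{a/2+2} · (that quotient evaluated at q) is a polynomial in q of degree 10a + 12, which equals the dimension of the nilpotent orbit O_a of the series labeled g_Q. -/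
/-!
STATEMENT 9.
For each `a ∈ {2,4,8}`, in `ℤ[X]` the product
`(X^{a/2}−1)(X^{a/2+2}−1)(X^{a+2}−1)(X^{a+4}−1)` divides
`(X^{3a/2}−1)(X^{3a/2+2}−1)(X^{2a+2}−1)(X^{2a+4}−1)(X^{5a/2+4}−1)(X^{3a+6}−1)`,
the quotient `Q` has degree `(19a+20)/2`, and
`Z_{g_Q}(q) = q^{a/2+2}·Q(q)` is a polynomial in `q` of degree `10a+12`,
the dimension of the nilpotent orbit `O_a` of the series labeled `g_Q`.
-/

open Polynomial

theorem rational_points_gQ_series_polynomial :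
    ∀ a ∈ ({2, 4, 8} : Set ℕ),
      ∃ Q : Polynomial ℤ,
        (X ^ (3 * a / 2) - 1) * (X ^ (3 * a / 2 + 2) - 1) * (X ^ (2 * a + 2) - 1) *
            (X ^ (2 * a + 4) - 1) * (X ^ (5 * a / 2 + 4) - 1) * (X ^ (3 * a + 6) - 1)
          = (X ^ (a / 2) - 1) * (X ^ (a / 2 + 2) - 1) * (X ^ (a + 2) - 1) *
              (X ^ (a + 4) - 1) * Q
        ∧ Q.natDegree = (19 * a + 20) / 2
        ∧ ((X : Polynomial ℤ) ^ (a / 2 + 2) * Q).natDegree = 10 * a + 12 := by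
  rintro a (rfl | rfl | rfl)
  · have hdeg : ((X ^ 4 + X ^ 3 + X ^ 2 + X + 1) * (X ^ 4 + 1) * (X ^ 9 - 1) *
        (X ^ 12 - 1) : ℤ[X]).natDegree = 29 := by
      compute_degree!
    refine ⟨_, ?_, hdeg, ?_⟩
    · ring
    · rw [natDegree_X_pow_mul _ (by intro h; simp [h] at hdeg), hdeg]
  · have hdeg : ((X ^ 8 + X ^ 6 + X ^ 4 + X ^ 2 + 1) * (X ^ 8 + X ^ 4 + 1) * (X ^ 14 - 1) *
        (X ^ 18 - 1) : ℤ[X]).natDegree = 48 := by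
      compute_degree!
    refine ⟨_, ?_, hdeg, ?_⟩
    · ring
    · rw [natDegree_X_pow_mul _ (by intro h; simp [h] at hdeg), hdeg]
  · have hdeg : ((X ^ 16 + X ^ 12 + X ^ 8 + X ^ 4 + 1) * (X ^ 12 + X ^ 6 + 1) *
        (X ^ 20 + X ^ 10 + 1) * (X ^ 14 - 1) * (X ^ 24 - 1) : ℤ[X]).natDegree = 86 := by
      compute_degree!
    refine ⟨_, ?_, hdeg, ?_⟩
    · ring
    · rw [natDegree_X_pow_mul _ (by intro h; simp [h] at hdeg), hdeg]
end

section
/- For each a ∈ {2, 4, 8}, in the polynomial ring ℤ[X] the product (X^{a/2+1} − 1)(X^{a/2+2} − 1)(X^{a+1} − 1) divides the product (X^{3a/2+2} − 1)(X^{2a+2} − 1)(X^{2a+4} − 1)(X^{5a/2+4} − 1)(X^{3a+6} − 1), and the quotient has degree 9a + 14. Consequently Z_{g²}(q) = q^{3a+4} · (that quotient evaluated at q) is a polynomial in q of degree 12a + 18, which equals the dimension of the nilpotent orbit O_a of the series labeled g². -/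
/-!
STATEMENT 11.
For each `a ∈ {2,4,8}`, in `ℤ[X]` the product
`(X^{a/2+1}−1)(X^{a/2+2}−1)(X^{a+1}−1)` divides
`(X^{3a/2+2}−1)(X^{2a+2}−1)(X^{2a+4}−1)(X^{5a/2+4}−1)(X^{3a+6}−1)`,
the quotient `Q` has degree `9a+14`, and
`Z_{g²}(q) = q^{3a+4}·Q(q)` is a polynomial in `q` of degree `12a+18`,
the dimension of the nilpotent orbit `O_a` of the series labeled `g²`.
-/

open Polynomial

theorem rational_points_gsq_series_polynomial :
    ∀ a ∈ ({2, 4, 8} : Set ℕ),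
      ∃ Q : Polynomial ℤ,
        (X ^ (3 * a / 2 + 2) - 1) * (X ^ (2 * a + 2) - 1) * (X ^ (2 * a + 4) - 1) *
            (X ^ (5 * a / 2 + 4) - 1) * (X ^ (3 * a + 6) - 1)
          = (X ^ (a / 2 + 1) - 1) * (X ^ (a / 2 + 2) - 1) * (X ^ (a + 1) - 1) * Q
        ∧ Q.natDegree = 9 * a + 14
        ∧ ((X : Polynomial ℤ) ^ (3 * a + 4) * Q).natDegree = 12 * a + 18 := by
  intro a ha
  suffices h : ∃ Q : Polynomial ℤ,
      (X ^ (3 * a / 2 + 2) - 1) * (X ^ (2 * a + 2) - 1) * (X ^ (2 * a + 4) - 1) *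
            (X ^ (5 * a / 2 + 4) - 1) * (X ^ (3 * a + 6) - 1)
          = (X ^ (a / 2 + 1) - 1) * (X ^ (a / 2 + 2) - 1) * (X ^ (a + 1) - 1) * Q
        ∧ Q.natDegree = 9 * a + 14 by
    obtain ⟨Q, hQ, hdeg⟩ := h
    refine ⟨Q, hQ, hdeg, ?_⟩
    have hQ0 : Q ≠ 0 := ne_zero_of_natDegree_gt (n := 0) (by lia)
    rw [natDegree_X_pow_mul _ hQ0, hdeg]
    lia
  rcases ha with rfl | rfl | rfl
  · refine ⟨(X ^ 5 - 1) * (X ^ 3 + 1) * (X ^ 6 + X ^ 4 + X ^ 2 + 1) * (X ^ 6 + X ^ 3 + 1) *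
      (X ^ 12 - 1), ?_, by compute_degree!⟩
    norm_num only
    ring
  · refine ⟨(X ^ 4 + 1) * (X ^ 5 + 1) * (X ^ 12 - 1) * (X ^ 14 - 1) *
      (X ^ 15 + X ^ 12 + X ^ 9 + X ^ 6 + X ^ 3 + 1), ?_, by compute_degree!⟩
    norm_num only
    ring
  · refine ⟨(X ^ 14 - 1) * (X ^ 9 + 1) * (X ^ 15 + X ^ 10 + X ^ 5 + 1) *
      (X ^ 18 + X ^ 12 + X ^ 6 + 1) * (X ^ 30 - 1), ?_, by compute_degree!⟩
    norm_num only
    ring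
end

section
/- For each a ∈ {2, 4, 8}, in the polynomial ring ℤ[X] the product (X² − 1)(X⁶ − 1)(X⁸ − 1)(X^{12} − 1)(X^{a/2+2} − 1)(X^{a/2+4} − 1)(X^{a/2+8} − 1) divides the product (X^a − 1)(X^{3a/2} − 1)(X^{3a/2+2} − 1)(X^{2a+2} − 1)(X^{2a+4} − 1)(X^{5a/2+4} − 1)(X^{3a+6} − 1), and the quotient has degree 12a − 24. Consequently the degree formula q^{N−12a−12}(q^a−1)(q^{3a/2}−1)(q^{3a/2+2}−1)(q^{2a+2}−1)(q^{2a+4}−1)(q^{5a/2+4}−1)(q^{3a+6}−1)/((q²−1)(q⁶−1)(q⁸−1)(q^{12}−1)(q^{a/2+2}−1)(q^{a/2+4}−1)(q^{a/2+8}−1)) for the unipotent character associated through the Springer correspondence to the nilpotent orbit series labeled g²g₂²g₃²g_Q² defines a polynomial in q, of degree N − 36 where N is the number of positive roots. -/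
/-!
STATEMENT 14.
For each `a ∈ {2,4,8}`, in `ℤ[X]` the product
`(X²−1)(X⁶−1)(X⁸−1)(X¹²−1)(X^{a/2+2}−1)(X^{a/2+4}−1)(X^{a/2+8}−1)` divides
`(X^a−1)(X^{3a/2}−1)(X^{3a/2+2}−1)(X^{2a+2}−1)(X^{2a+4}−1)(X^{5a/2+4}−1)(X^{3a+6}−1)`,
the quotient `Q` has degree `12a−24`, and the degree formula
`q^{N−12a−12}·Q(q)` for the unipotent character associated through the
Springer correspondence to the nilpotent orbit series labeled
`g²g₂²g₃²g_Q²` defines a polynomial in `q` of degree `N − 36`, where `N` is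
the number of positive roots (`N = 36, 63, 120` for `a = 2, 4, 8`).
-/

open Polynomial

/-- The polynomial `Xⁿ - 1` is divisible by `Xᵐ - 1` when `n = m * k`, with geometric quotient. -/
theorem X_pow_mul_sub_one_eq_mul_geom_sum {R : Type*} [CommRing R] (m k : ℕ) :
    (X : R[X]) ^ (m * k) - 1 = (X ^ m - 1) * ∑ i ∈ Finset.range k, X ^ (m * i) := by
  simp_rw [pow_mul]
  exact (mul_geom_sum _ _).symm

theorem unipotent_character_degree_regular_series_polynomial :
    ∀ a ∈ ({2, 4, 8} : Set ℕ), ∀ N : ℕ,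
      N = (if a = 2 then 36 else if a = 4 then 63 else 120) →
      ∃ Q : Polynomial ℤ,
        (X ^ a - 1) * (X ^ (3 * a / 2) - 1) * (X ^ (3 * a / 2 + 2) - 1) *
            (X ^ (2 * a + 2) - 1) * (X ^ (2 * a + 4) - 1) *
            (X ^ (5 * a / 2 + 4) - 1) * (X ^ (3 * a + 6) - 1)
          = (X ^ 2 - 1) * (X ^ 6 - 1) * (X ^ 8 - 1) * (X ^ 12 - 1) *
              (X ^ (a / 2 + 2) - 1) * (X ^ (a / 2 + 4) - 1) *
              (X ^ (a / 2 + 8) - 1) * Q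
        ∧ Q.natDegree = 12 * a - 24
        ∧ ((X : Polynomial ℤ) ^ (N - 12 * a - 12) * Q).natDegree = N - 36 := by
  rintro a (rfl | rfl | rfl) N rfl
  · exact ⟨1, by norm_num; ring, by simp, by simp⟩
  · have h14 := X_pow_mul_sub_one_eq_mul_geom_sum (R := ℤ) 2 7
    have h18 := X_pow_mul_sub_one_eq_mul_geom_sum (R := ℤ) 6 3
    simp only [Finset.sum_range_succ, Finset.sum_range_zero] at h14 h18
    norm_num at h14 h18 ⊢
    refine ⟨(1 + X ^ 2 + X ^ 4 + X ^ 6 + X ^ 8 + X ^ 10 + X ^ 12) * (1 + X ^ 6 + X ^ 12),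
      ?_, by compute_degree!, by compute_degree!⟩
    rw [h14, h18]
    simp only [mul_assoc, mul_comm, mul_left_comm]
  · have h14 := X_pow_mul_sub_one_eq_mul_geom_sum (R := ℤ) 2 7
    have h18 := X_pow_mul_sub_one_eq_mul_geom_sum (R := ℤ) 6 3
    have h20 := X_pow_mul_sub_one_eq_mul_geom_sum (R := ℤ) 4 5
    have h30 := X_pow_mul_sub_one_eq_mul_geom_sum (R := ℤ) 6 5
    simp only [Finset.sum_range_succ, Finset.sum_range_zero] at h14 h18 h20 h30
    norm_num at h14 h18 h20 h30 ⊢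
    have h24 : ((X : ℤ[X]) ^ 4 - 1) * (X ^ 24 - 1) =
        (X ^ 8 - 1) * (X ^ 12 - 1) * (1 - X ^ 4 + X ^ 8) := by ring
    refine ⟨(1 + X ^ 2 + X ^ 4 + X ^ 6 + X ^ 8 + X ^ 10 + X ^ 12) * (1 + X ^ 6 + X ^ 12) *
        (1 + X ^ 4 + X ^ 8 + X ^ 12 + X ^ 16) * (1 + X ^ 6 + X ^ 12 + X ^ 18 + X ^ 24) *
        (1 - X ^ 4 + X ^ 8), ?_, by compute_degree!, by compute_degree!⟩
    rw [h14, h18, h20, h30]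
    generalize (1 + X ^ 2 + X ^ 4 + X ^ 6 + X ^ 8 + X ^ 10 + X ^ 12 : ℤ[X]) = A
    generalize (1 + X ^ 6 + X ^ 12 + X ^ 18 + X ^ 24 : ℤ[X]) = D
    generalize (1 + X ^ 6 + X ^ 12 : ℤ[X]) = B
    generalize (1 + X ^ 4 + X ^ 8 + X ^ 12 + X ^ 16 : ℤ[X]) = C
    linear_combination (X ^ 8 - 1) * (X ^ 12 - 1) * (X ^ 2 - 1) * (X ^ 6 - 1) ^ 2 *
      A * B * C * D * h24
end
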